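/- Let F_q be a finite field of characteristic p and let k be a positive integer with p ∤ (k + 2). For m = (m_0, …, m_{k−1}) ∈ F_q^k and x ∈ F_q define g(x, m) = x^{k+2} + Σ_{i=1}^{k} m_{i−1} x^i. Then for every m ∈ F_q^k and every triple (Δm, Δx, Δt) ∈ F_q^k × F_q × F_q with (Δm, Δx, Δt) ≠ (0, 0, 0), the number of x ∈ F_q satisfying g(x + Δx, m + Δm) = g(x, m) + Δt is at most k + 1. In particular, for x chosen uniformly at random from F_q, the probability that g(x + Δx, m + Δm) = g(x, m) + Δt is at most (k + 1)/q, so g yields a systematic (q^k, q^{k+2}, (k+1)/q)-algebraic manipulation detection code. -/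

import Mathlib

/-- The AMD tag function `g(x, m) = x^{k+2} + ∑_{i=1}^{k} m_{i-1} x^i`. -/
def amdTag {F : Type*} [Field F] (k : ℕ) (x : F) (m : Fin k → F) : F :=
  x ^ (k + 2) + ∑ i : Fin k, m i * x ^ ((i : ℕ) + 1)

open Polynomial in
theorem natDegree_sum_C_mul_X_add_C_pow_le {F : Type*} [Field F] (k : ℕ) (c : Fin k → F) (a : F) :
    (∑ i : Fin k, C (c i) * (X + C a) ^ ((i : ℕ) + 1)).natDegree ≤ k := by
  refine natDegree_sum_le_of_forall_le _ _ fun i _ => ?_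
  refine (natDegree_C_mul_le _ _).trans ?_
  rw [natDegree_pow, natDegree_X_add_C]
  omega

open Polynomial in
theorem coeff_X_add_C_pow_sub_X_pow {F : Type*} [Field F] (k : ℕ) (a : F) :
    ((X + C a) ^ (k + 2) - X ^ (k + 2) : F[X]).coeff (k + 1) = a * ((k + 2 : ℕ) : F) := by
  rw [coeff_sub, coeff_X_add_C_pow, coeff_X_pow, if_neg (by omega), sub_zero,
    show k + 2 - (k + 1) = 1 by omega, pow_one, Nat.choose_succ_self_right]

open Polynomial in
theorem natDegree_X_add_C_pow_sub_X_pow_le {F : Type*} [Field F] (k : ℕ) (a : F) :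
    ((X + C a) ^ (k + 2) - X ^ (k + 2) : F[X]).natDegree ≤ k + 1 := by
  rw [natDegree_le_iff_coeff_eq_zero]
  intro n hn
  rw [coeff_sub, coeff_X_add_C_pow, coeff_X_pow]
  rcases eq_or_lt_of_le (Nat.succ_le_of_lt hn) with h | h
  · subst h
    simp
  · rw [Nat.choose_eq_zero_of_lt (by omega), if_neg (by omega)]
    simp

open Polynomial in
/-- The polynomial in `x` whose roots are the seeds for which the manipulation is accepted. -/
noncomputable def amdErrorPoly {F : Type*} [Field F] (k : ℕ) (m Δm : Fin k → F) (Δx Δt : F) :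
    F[X] :=
  ((X + C Δx) ^ (k + 2) - X ^ (k + 2)) +
    (∑ i : Fin k, C (m i + Δm i) * (X + C Δx) ^ ((i : ℕ) + 1) -
      ∑ i : Fin k, C (m i) * (X + C 0) ^ ((i : ℕ) + 1) - C Δt)

open Polynomial in
theorem eval_amdErrorPoly {F : Type*} [Field F] (k : ℕ) (m Δm : Fin k → F) (Δx Δt x : F) :
    (amdErrorPoly k m Δm Δx Δt).eval x =
      amdTag k (x + Δx) (fun i => m i + Δm i) - (amdTag k x m + Δt) := by
  simp only [amdErrorPoly, amdTag, eval_add, eval_sub, eval_pow, eval_X, eval_C, eval_mul,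
    eval_finsetSum, add_zero]
  ring

open Polynomial in
theorem natDegree_amdErrorPoly_tail_le {F : Type*} [Field F] (k : ℕ) (m Δm : Fin k → F)
    (Δx Δt : F) :
    (∑ i : Fin k, C (m i + Δm i) * (X + C Δx) ^ ((i : ℕ) + 1) -
      ∑ i : Fin k, C (m i) * (X + C 0) ^ ((i : ℕ) + 1) - C Δt).natDegree ≤ k := by
  refine (natDegree_sub_le _ _).trans (max_le ((natDegree_sub_le _ _).trans (max_le ?_ ?_)) ?_)
  · exact natDegree_sum_C_mul_X_add_C_pow_le k (fun i => m i + Δm i) Δx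
  · exact natDegree_sum_C_mul_X_add_C_pow_le k m 0
  · simp

theorem natDegree_amdErrorPoly_le {F : Type*} [Field F] (k : ℕ) (m Δm : Fin k → F) (Δx Δt : F) :
    (amdErrorPoly k m Δm Δx Δt).natDegree ≤ k + 1 :=
  Polynomial.natDegree_add_le_of_degree_le (natDegree_X_add_C_pow_sub_X_pow_le k Δx)
    ((natDegree_amdErrorPoly_tail_le k m Δm Δx Δt).trans k.le_succ)

open Polynomial in
theorem amdErrorPoly_ne_zero {F : Type*} [Field F] (p : ℕ) [CharP F p] (k : ℕ)
    (hpk : ¬ p ∣ (k + 2)) (m Δm : Fin k → F) (Δx Δt : F)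
    (hδ : ¬ (Δm = 0 ∧ Δx = 0 ∧ Δt = 0)) : amdErrorPoly k m Δm Δx Δt ≠ 0 := by
  intro h
  have hx : Δx = 0 := by
    have hc := congrArg (fun P => P.coeff (k + 1)) h
    simp only [amdErrorPoly, coeff_zero] at hc
    rw [coeff_add, coeff_X_add_C_pow_sub_X_pow, coeff_eq_zero_of_natDegree_lt
      (Nat.lt_succ_of_le (natDegree_amdErrorPoly_tail_le k m Δm Δx Δt)), add_zero] at hc
    exact (mul_eq_zero.mp hc).resolve_right fun h0 => hpk ((CharP.cast_eq_zero_iff F p _).mp h0)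
  subst hx
  have h' : ∑ i : Fin k, C (Δm i) * X ^ ((i : ℕ) + 1) - C Δt = 0 := by
    rw [← h]
    simp only [amdErrorPoly, C_0, add_zero, sub_self, zero_add, C_add, add_mul,
      Finset.sum_add_distrib]
    ring
  refine hδ ⟨funext fun j => ?_, rfl, ?_⟩
  · have hc := congrArg (fun P => P.coeff ((j : ℕ) + 1)) h'
    simpa [finsetSum_coeff, coeff_X_pow, coeff_C, Fin.val_inj] using hc
  · have hc := congrArg (fun P => P.coeff 0) h'
    simpa [finsetSum_coeff, coeff_X_pow] using hc

/-- if `p ∤ k + 2`, then for any message `m` and any nonzero manipulation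
`(Δm, Δx, Δt)`, at most `k + 1` elements `x ∈ F_q` satisfy
`g(x + Δx, m + Δm) = g(x, m) + Δt`; hence for uniformly random `x` the manipulation is
accepted with probability at most `(k + 1)/q`, so `g` yields a systematic
`(q^k, q^{k+2}, (k+1)/q)`-AMD code. -/
theorem amd_manipulation_detection {F : Type*} [Field F] [Fintype F] [DecidableEq F]
    (p : ℕ) [CharP F p] (k : ℕ) (hk : 0 < k) (hpk : ¬ p ∣ (k + 2))
    (m Δm : Fin k → F) (Δx Δt : F) (hδ : ¬ (Δm = 0 ∧ Δx = 0 ∧ Δt = 0)) :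
    (Finset.univ.filter fun x : F =>
        amdTag k (x + Δx) (fun i => m i + Δm i) = amdTag k x m + Δt).card ≤ k + 1 ∧
    ((Finset.univ.filter fun x : F =>
        amdTag k (x + Δx) (fun i => m i + Δm i) = amdTag k x m + Δt).card : ℝ) /
        (Fintype.card F : ℝ) ≤ ((k : ℝ) + 1) / (Fintype.card F : ℝ) := by
  have hcard : (Finset.univ.filter fun x : F =>
      amdTag k (x + Δx) (fun i => m i + Δm i) = amdTag k x m + Δt).card ≤ k + 1 := by
    have hP := amdErrorPoly_ne_zero p k hpk m Δm Δx Δt hδ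
    refine (Polynomial.card_le_degree_of_subset_roots fun x hx => ?_).trans
      (natDegree_amdErrorPoly_le k m Δm Δx Δt)
    rw [Polynomial.mem_roots hP, Polynomial.IsRoot, eval_amdErrorPoly, sub_eq_zero]
    simpa using hx
  refine ⟨hcard, ?_⟩
  gcongr
  exact_mod_cast hcard
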